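/- arXiv:cs/0407018 — 8 statements merged into one kernel-verified Lean document; each statement's English description precedes it below -/
import Mathlib

section
/- Let A, B, C be affinely independent points in the Euclidean plane ℝ² with interior angles a = ∠BAC, b = ∠ABC, c = ∠BCA, and assume a < c. Let F lie strictly between A and B with ∠FCB = a; let D lie strictly between A and C with ∠DFC = b; let E lie strictly between A and F with ∠ADE = b; and let G lie strictly between C and F with ∠GDC = a. Then each of the five triangles ADE, DEF, DGF, CDG, BCF has its multiset of interior angles equal either to {a, b, c} or to {a, c − a, π − c}. In particular BCF has angles b at B, a at C, c at F (so it is similar to ABC). -/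
open Real EuclideanGeometry

/-- Generalized pinwheel subdivision of a triangle `ABC` with angles
`a = ∠BAC`, `b = ∠ABC`, `c = ∠BCA`, `a < c`.  With `F` strictly between `A`
and `B` such that `∠FCB = a`, `D` strictly between `A` and `C` such that
`∠DFC = b`, `E` strictly between `A` and `F` such that `∠ADE = b`, and `G`
strictly between `C` and `F` such that `∠GDC = a`, each of the five triangles
`ADE`, `DEF`, `DGF`, `CDG`, `BCF` has its multiset of interior angles equal to
`{a, b, c}` or to `{a, c - a, π - c}`; in particular `BCF` has angle `b` at
`B`, `a` at `C` and `c` at `F`. -/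
theorem generalized_pinwheel_subdivision_angles
    (A B C D E F G : EuclideanSpace ℝ (Fin 2))
    (hABC : AffineIndependent ℝ ![A, B, C])
    (a b c : ℝ)
    (ha : a = ∠ B A C) (hb : b = ∠ A B C) (hc : c = ∠ B C A)
    (hac : a < c)
    (hF : Sbtw ℝ A F B) (hFCB : ∠ F C B = a)
    (hD : Sbtw ℝ A D C) (hDFC : ∠ D F C = b)
    (hE : Sbtw ℝ A E F) (hADE : ∠ A D E = b)
    (hG : Sbtw ℝ C G F) (hGDC : ∠ G D C = a) :
    (({∠ D A E, ∠ A D E, ∠ A E D} : Multiset ℝ) = ({a, b, c} : Multiset ℝ) ∨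
      ({∠ D A E, ∠ A D E, ∠ A E D} : Multiset ℝ) =
        ({a, c - a, Real.pi - c} : Multiset ℝ)) ∧
    (({∠ E D F, ∠ D E F, ∠ D F E} : Multiset ℝ) = ({a, b, c} : Multiset ℝ) ∨
      ({∠ E D F, ∠ D E F, ∠ D F E} : Multiset ℝ) =
        ({a, c - a, Real.pi - c} : Multiset ℝ)) ∧
    (({∠ G D F, ∠ D G F, ∠ D F G} : Multiset ℝ) = ({a, b, c} : Multiset ℝ) ∨
      ({∠ G D F, ∠ D G F, ∠ D F G} : Multiset ℝ) =
        ({a, c - a, Real.pi - c} : Multiset ℝ)) ∧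
    (({∠ D C G, ∠ C D G, ∠ C G D} : Multiset ℝ) = ({a, b, c} : Multiset ℝ) ∨
      ({∠ D C G, ∠ C D G, ∠ C G D} : Multiset ℝ) =
        ({a, c - a, Real.pi - c} : Multiset ℝ)) ∧
    (({∠ C B F, ∠ B C F, ∠ B F C} : Multiset ℝ) = ({a, b, c} : Multiset ℝ) ∨
      ({∠ C B F, ∠ B C F, ∠ B F C} : Multiset ℝ) =
        ({a, c - a, Real.pi - c} : Multiset ℝ)) ∧
    ∠ C B F = b ∧ ∠ B C F = a ∧ ∠ B F C = c := by
  have hAB : A ≠ B := hABC.injective.ne (show (0 : Fin 3) ≠ 1 by decide)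
  have habc : a + b + c = π := by
    linarith [angle_add_angle_add_angle_eq_pi C hAB.symm, angle_comm C A B]
  -- Triangle `BCF`.
  have hCBF : ∠ C B F = b := by
    rw [hF.symm.angle_eq_right, angle_comm, hb]
  have hBCF : ∠ B C F = a := by rw [angle_comm, hFCB]
  have hBFC : ∠ B F C = c := by
    linarith [angle_add_angle_add_angle_eq_pi C hF.ne_right, angle_comm F C B, angle_comm C B F]
  -- Triangle `ADE`.
  have hDAF : ∠ D A F = a := by
    rw [hD.angle_eq_left, hF.angle_eq_right, angle_comm, ha]
  have hDAE : ∠ D A E = a := by rw [hE.angle_eq_right, hDAF]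
  have hAED : ∠ A E D = c := by
    linarith [angle_add_angle_add_angle_eq_pi D hE.left_ne.symm, angle_comm E D A]
  -- Triangle `DEF`.
  have hDEF : ∠ D E F = π - c := by
    linarith [angle_add_angle_eq_pi_of_angle_eq_pi D hE.angle₁₂₃_eq_pi, angle_comm D E A]
  have hDFE : ∠ D F E = a := by
    rw [hE.symm.angle_eq_right]
    linarith [angle_add_angle_eq_pi_of_angle_eq_pi C hF.angle₁₂₃_eq_pi,
      angle_add_angle_eq_of_sbtw (p := F) hD, angle_comm D F A, angle_comm C F A,
      angle_comm C F B]
  have hEDF : ∠ E D F = c - a := by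
    linarith [angle_add_angle_add_angle_eq_pi D hE.ne_right.symm, angle_comm E F D,
      angle_comm D E F, angle_comm F D E]
  -- Triangle `CDG`.
  have hCDG : ∠ C D G = a := by rw [angle_comm, hGDC]
  have hDCG : ∠ D C G = c - a := by
    rw [hD.symm.angle_eq_left, hG.angle_eq_right]
    linarith [angle_add_angle_eq_of_sbtw (p := C) hF, angle_comm A C B]
  have hCGD : ∠ C G D = π - c := by
    linarith [angle_add_angle_add_angle_eq_pi D hG.left_ne.symm, angle_comm G D C,
      angle_comm D C G]
  -- Triangle `DGF`.
  have hDFG : ∠ D F G = b := by rw [hG.symm.angle_eq_right, hDFC]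
  have hDGF : ∠ D G F = c := by
    linarith [angle_add_angle_eq_pi_of_angle_eq_pi D hG.angle₁₂₃_eq_pi, angle_comm D G C]
  have hGDF : ∠ G D F = a := by
    linarith [angle_add_angle_add_angle_eq_pi D hG.ne_right.symm, angle_comm G F D,
      angle_comm D G F, angle_comm F D G]
  rw [hDAE, hADE, hAED, hEDF, hDEF, hDFE, hGDF, hDGF, hDFG, hDCG, hCDG, hCGD, hCBF, hBCF, hBFC]
  have hswap (x y z : ℝ) : ({x, y, z} : Multiset ℝ) = {y, x, z} := Multiset.cons_swap x y {z}
  refine ⟨.inl rfl, .inr ?_, .inl ?_, .inr (hswap _ _ _), .inl (hswap _ _ _), rfl, rfl, rfl⟩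
  · rw [hswap a, Multiset.pair_comm a]
  · rw [Multiset.pair_comm c b]
end

section
/- Let v₁, v₂, v₃ be affinely independent points in ℝ² and suppose the triangle with these vertices lies between two parallel lines at distance α apart; that is, there exist a unit vector u ∈ ℝ² and a real number r such that r ≤ ⟨u, vᵢ⟩ ≤ r + α for i = 1, 2, 3. Then the minimum altitude of the triangle is at most α. -/
open Real EuclideanGeometry
open scoped RealInnerProductSpace

/-- The minimum altitude of the triangle with vertices `v₁ v₂ v₃`: the minimum
over `i` of the distance from `vᵢ` to the affine span of the other two vertices. -/
noncomputable def minalt (v₁ v₂ v₃ : EuclideanSpace ℝ (Fin 2)) : ℝ :=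
  min (Metric.infDist v₁ (affineSpan ℝ {v₂, v₃} : Set (EuclideanSpace ℝ (Fin 2))))
    (min (Metric.infDist v₂ (affineSpan ℝ {v₁, v₃} : Set (EuclideanSpace ℝ (Fin 2))))
      (Metric.infDist v₃ (affineSpan ℝ {v₁, v₂} : Set (EuclideanSpace ℝ (Fin 2)))))

lemma cross_sq_le_of_le_normSq {x₁ y₁ x₂ y₂ α : ℝ} (hx₁ : x₁ ≤ 0) (hx₂ : 0 ≤ x₂)
    (hα : x₂ - x₁ ≤ α) (h : x₂ ^ 2 + y₂ ^ 2 ≤ x₁ ^ 2 + y₁ ^ 2) :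
    (x₁ * y₂ - y₁ * x₂) ^ 2 ≤ α ^ 2 * (x₁ ^ 2 + y₁ ^ 2) := by
  set m := √(x₁ ^ 2 + y₁ ^ 2)
  have hm : m ^ 2 = x₁ ^ 2 + y₁ ^ 2 := Real.sq_sqrt (by positivity)
  have hm₀ : 0 ≤ m := Real.sqrt_nonneg _
  obtain ⟨h₁, h₁'⟩ := abs_le_of_sq_le_sq' (show y₁ ^ 2 ≤ m ^ 2 by nlinarith) hm₀
  obtain ⟨h₂, h₂'⟩ := abs_le_of_sq_le_sq' (show y₂ ^ 2 ≤ m ^ 2 by nlinarith) hm₀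
  rw [← hm, ← mul_pow]
  apply sq_le_sq' <;> nlinarith

/-- If `b` lies between `a` and `c` in the direction `u` and `c` is no farther from `b` than `a` is,
then the distance from `c` to the line through `a` and `b` is at most the width in direction `u`. -/
lemma infDist_affineSpan_pair_le_of_dist_le {a b c u : EuclideanSpace ℝ (Fin 2)} {α : ℝ}
    (hu : ‖u‖ = 1) (hab : ⟪u, a⟫ ≤ ⟪u, b⟫) (hbc : ⟪u, b⟫ ≤ ⟪u, c⟫)
    (hα : ⟪u, c⟫ - ⟪u, a⟫ ≤ α) (hd : dist c b ≤ dist a b) (hne : a ≠ b) :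
    Metric.infDist c (affineSpan ℝ {a, b} : Set (EuclideanSpace ℝ (Fin 2))) ≤ α := by
  have hN : 0 < dist a b ^ 2 := by have := dist_pos.2 hne; positivity
  have hd2 : dist c b ^ 2 ≤ dist a b ^ 2 := by gcongr
  have hu2 : ‖u‖ ^ 2 = 1 := by rw [hu, one_pow]
  let k : ℝ := ⟪a - b, c - b⟫ / dist a b ^ 2
  have hk : k * dist a b ^ 2 = ⟪a - b, c - b⟫ := div_mul_cancel₀ _ hN.ne'
  refine (Metric.infDist_le_dist_of_mem (y := AffineMap.lineMap a b (1 - k))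
    (AffineMap.lineMap_mem_affineSpan_pair _ _ _)).trans ?_
  refine abs_le_of_sq_le_sq (a := dist _ _) ?_ (by linarith) |> (le_abs_self _).trans
  clear_value k
  simp only [EuclideanSpace.dist_sq_eq, EuclideanSpace.norm_sq_eq, PiLp.inner_apply,
    Fin.sum_univ_two, Real.dist_eq, sq_abs, Real.norm_eq_abs, RCLike.inner_apply, conj_trivial,
    AffineMap.lineMap_apply, vsub_eq_sub, vadd_eq_add, PiLp.add_apply, PiLp.sub_apply,
    PiLp.smul_apply, smul_eq_mul] at *
  generalize hp₀ : a 0 - b 0 = p₀ at *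
  generalize hp₁ : a 1 - b 1 = p₁ at *
  generalize hq₀ : c 0 - b 0 = q₀ at *
  generalize hq₁ : c 1 - b 1 = q₁ at *
  have rotate (x y : ℝ) :
      (u 0 * x + u 1 * y) ^ 2 + (u 0 * y - u 1 * x) ^ 2 = x ^ 2 + y ^ 2 := by
    linear_combination (x ^ 2 + y ^ 2) * hu2
  have key := cross_sq_le_of_le_normSq (α := α)
    (x₁ := u 0 * p₀ + u 1 * p₁) (y₁ := u 0 * p₁ - u 1 * p₀)
    (x₂ := u 0 * q₀ + u 1 * q₁) (y₂ := u 0 * q₁ - u 1 * q₀)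
    (by subst p₀ p₁; linarith) (by subst q₀ q₁; linarith)
    (by subst p₀ p₁ q₀ q₁; linarith) (by rw [rotate, rotate]; exact hd2)
  have cross : (u 0 * p₀ + u 1 * p₁) * (u 0 * q₁ - u 1 * q₀)
      - (u 0 * p₁ - u 1 * p₀) * (u 0 * q₀ + u 1 * q₁) = p₀ * q₁ - p₁ * q₀ := by
    linear_combination (p₀ * q₁ - p₁ * q₀) * hu2
  rw [rotate, cross] at key
  have e₀ : c 0 - ((1 - k) * (b 0 - a 0) + a 0) = q₀ - k * p₀ := by subst p₀ q₀; ring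
  have e₁ : c 1 - ((1 - k) * (b 1 - a 1) + a 1) = q₁ - k * p₁ := by subst p₁ q₁; ring
  rw [e₀, e₁]
  refine le_of_mul_le_mul_right (le_of_eq_of_le ?_ key) hN
  linear_combination (k * (p₀ ^ 2 + p₁ ^ 2) - (p₀ * q₀ + p₁ * q₁)) * hk

/-- If `b` lies between `a` and `c` in the direction `u`, then one of the altitudes from `a` and `c`
is at most the width of the triangle in direction `u`. -/
lemma infDist_affineSpan_pair_le_or_of_inner_le {a b c u : EuclideanSpace ℝ (Fin 2)} {α : ℝ}
    (hu : ‖u‖ = 1) (hab : ⟪u, a⟫ ≤ ⟪u, b⟫) (hbc : ⟪u, b⟫ ≤ ⟪u, c⟫)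
    (hα : ⟪u, c⟫ - ⟪u, a⟫ ≤ α) (hne : a ≠ b) (hne' : c ≠ b) :
    Metric.infDist a (affineSpan ℝ {b, c} : Set (EuclideanSpace ℝ (Fin 2))) ≤ α ∨
      Metric.infDist c (affineSpan ℝ {a, b} : Set (EuclideanSpace ℝ (Fin 2))) ≤ α := by
  rcases le_total (dist a b) (dist c b) with h | h
  · left
    rw [Set.pair_comm]
    refine infDist_affineSpan_pair_le_of_dist_le (u := -u) (by rwa [norm_neg]) ?_ ?_ ?_ h hne' <;>
      simp only [inner_neg_left] <;> linarith
  · exact Or.inr (infDist_affineSpan_pair_le_of_dist_le hu hab hbc hα h hne)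

/-- If a triangle lies between two parallel lines at distance `α` apart, then
its minimum altitude is at most `α`. -/
theorem minalt_le_of_between_parallel_lines (v₁ v₂ v₃ : EuclideanSpace ℝ (Fin 2))
    (hind : AffineIndependent ℝ ![v₁, v₂, v₃]) (α : ℝ)
    (u : EuclideanSpace ℝ (Fin 2)) (hu : ‖u‖ = 1) (r : ℝ)
    (h₁ : r ≤ ⟪u, v₁⟫ ∧ ⟪u, v₁⟫ ≤ r + α)
    (h₂ : r ≤ ⟪u, v₂⟫ ∧ ⟪u, v₂⟫ ≤ r + α)
    (h₃ : r ≤ ⟪u, v₃⟫ ∧ ⟪u, v₃⟫ ≤ r + α) :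
    minalt v₁ v₂ v₃ ≤ α := by
  have h₁₂ : v₁ ≠ v₂ := hind.injective.ne (show (0 : Fin 3) ≠ 1 by decide)
  have h₁₃ : v₁ ≠ v₃ := hind.injective.ne (show (0 : Fin 3) ≠ 2 by decide)
  have h₂₃ : v₂ ≠ v₃ := hind.injective.ne (show (1 : Fin 3) ≠ 2 by decide)
  have key {a b c : EuclideanSpace ℝ (Fin 2)} (ha : r ≤ ⟪u, a⟫) (hc : ⟪u, c⟫ ≤ r + α)
      (hab : ⟪u, a⟫ ≤ ⟪u, b⟫) (hbc : ⟪u, b⟫ ≤ ⟪u, c⟫) (hne : a ≠ b) (hne' : c ≠ b) :=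
    infDist_affineSpan_pair_le_or_of_inner_le hu hab hbc (α := α) (by linarith) hne hne'
  rw [minalt, min_le_iff, min_le_iff]
  rcases le_total ⟪u, v₁⟫ ⟪u, v₂⟫ with h | h <;>
    rcases le_total ⟪u, v₂⟫ ⟪u, v₃⟫ with h' | h'
  · have := key h₁.1 h₃.2 h h' h₁₂ h₂₃.symm
    tauto
  · rcases le_total ⟪u, v₁⟫ ⟪u, v₃⟫ with h'' | h''
    · have := key h₁.1 h₂.2 h'' h' h₁₃ h₂₃
      rw [Set.pair_comm v₃ v₂] at this
      tauto
    · have := key h₃.1 h₂.2 h'' h h₁₃.symm h₁₂.symm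
      rw [Set.pair_comm v₃ v₁] at this
      tauto
  · rcases le_total ⟪u, v₁⟫ ⟪u, v₃⟫ with h'' | h''
    · have := key h₂.1 h₃.2 h h'' h₁₂.symm h₁₃.symm
      rw [Set.pair_comm v₂ v₁] at this
      tauto
    · have := key h₂.1 h₁.2 h' h'' h₂₃ h₁₃
      rw [Set.pair_comm v₃ v₁] at this
      tauto
  · have := key h₃.1 h₁.2 h' h h₂₃.symm h₁₂
    rw [Set.pair_comm v₂ v₁, Set.pair_comm v₃ v₂] at this
    tauto
end

section
/- Let T₁ and T₂ be triangles in ℝ², each given by an affinely independent triple of vertices, such that T₁ ⊆ T₂ (the convex hull of the vertices of T₁ is contained in the convex hull of the vertices of T₂). Then minalt(T₁) ≤ minalt(T₂). -/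
open Real EuclideanGeometry

/-- The two-dimensional cross product (signed area of the spanned parallelogram). -/
def planarCross (x y : EuclideanSpace ℝ (Fin 2)) : ℝ := x 0 * y 1 - x 1 * y 0

lemma norm_sq_eq_coords (x : EuclideanSpace ℝ (Fin 2)) : ‖x‖ ^ 2 = x 0 ^ 2 + x 1 ^ 2 := by
  simp [EuclideanSpace.norm_sq_eq, Fin.sum_univ_two]

lemma abs_planarCross_le (x y : EuclideanSpace ℝ (Fin 2)) :
    |planarCross x y| ≤ ‖x‖ * ‖y‖ := by
  apply abs_le_of_sq_le_sq _ (by positivity)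
  rw [mul_pow, norm_sq_eq_coords, norm_sq_eq_coords, planarCross]
  nlinarith [sq_nonneg (x 0 * y 0 + x 1 * y 1)]

lemma planarCross_smul_eq (a b d : EuclideanSpace ℝ (Fin 2)) :
    planarCross a b • d = planarCross a d • b - planarCross b d • a := by
  ext i
  fin_cases i <;> simp [planarCross] <;> ring

/-- The distance from a point to a line, in terms of the cross product. -/
lemma infDist_line_eq (v a b : EuclideanSpace ℝ (Fin 2)) (hab : a ≠ b) :
    Metric.infDist v (affineSpan ℝ {a, b} : Set (EuclideanSpace ℝ (Fin 2))) =
      |planarCross (v - a) (b - a)| / ‖b - a‖ := by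
  have hpos : 0 < ‖b - a‖ := norm_pos_iff.2 (sub_ne_zero.2 hab.symm)
  have hN := norm_sq_eq_coords (b - a)
  have hN0 : (b - a) 0 ^ 2 + (b - a) 1 ^ 2 ≠ 0 := by rw [← hN]; positivity
  apply le_antisymm
  · set t : ℝ := ((v - a) 0 * (b - a) 0 + (v - a) 1 * (b - a) 1) / ‖b - a‖ ^ 2 with ht
    refine (Metric.infDist_le_dist_of_mem
      (AffineMap.lineMap_mem_affineSpan_pair t a b)).trans ?_
    rw [le_div_iff₀ hpos, dist_eq_norm]
    refine (sq_le_sq₀ (by positivity) (abs_nonneg _)).1 ?_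
    have h : v - AffineMap.lineMap a b t = (v - a) - t • (b - a) := by
      rw [AffineMap.lineMap_apply]
      simp only [vsub_eq_sub, vadd_eq_add]
      abel
    rw [h, mul_pow, sq_abs, norm_sq_eq_coords, hN, planarCross, ht, hN]
    generalize v - a = x at *
    generalize b - a = y at *
    simp only [PiLp.sub_apply, PiLp.smul_apply, smul_eq_mul]
    apply le_of_eq
    field_simp
    ring
  · rw [Metric.le_infDist ⟨a, left_mem_affineSpan_pair ℝ a b⟩]
    intro y hy
    obtain ⟨t, rfl⟩ := mem_affineSpan_pair_iff_exists_lineMap_eq.1 hy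
    rw [div_le_iff₀ hpos, dist_eq_norm]
    have h : planarCross (v - a) (b - a) = planarCross (v - AffineMap.lineMap a b t) (b - a) := by
      simp only [planarCross, AffineMap.lineMap_apply, vsub_eq_sub, vadd_eq_add,
        PiLp.sub_apply, PiLp.add_apply, PiLp.smul_apply, smul_eq_mul]
      ring
    rw [h]
    exact abs_planarCross_le _ _

lemma norm_smul_sub_smul_le {E : Type*} [NormedAddCommGroup E] [NormedSpace ℝ E]
    {a b : E} {α β L W : ℝ} (ha : ‖a‖ ≤ L) (hb : ‖b‖ ≤ L) (hab : ‖a - b‖ ≤ L)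
    (hα : |α| ≤ W) (hβ : |β| ≤ W) (hαβ : |α - β| ≤ W) :
    ‖α • b - β • a‖ ≤ L * W := by
  have hL : 0 ≤ L := (norm_nonneg a).trans ha
  have key : ∀ (r s : ℝ) (x y : E), ‖x‖ ≤ L → ‖y‖ ≤ L → |r| + |s| ≤ W →
      ‖r • x + s • y‖ ≤ L * W := by
    intro r s x y hx hy hrs
    calc ‖r • x + s • y‖ ≤ |r| * ‖x‖ + |s| * ‖y‖ := by
          simpa [norm_smul] using norm_add_le (r • x) (s • y)
      _ ≤ |r| * L + |s| * L := by gcongr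
      _ = L * (|r| + |s|) := by ring
      _ ≤ L * W := by gcongr
  have e₁ : α • b - β • a = α • b + (-β) • a := by module
  have e₂ : α • b - β • a = (α - β) • a + (-α) • (a - b) := by module
  have e₃ : α • b - β • a = (α - β) • b + (-β) • (a - b) := by module
  have h : |α| + |-β| ≤ W ∨ |α - β| + |-α| ≤ W ∨ |α - β| + |-β| ≤ W := by
    clear key e₁ e₂ e₃ ha hb hab hL
    grind
  rcases h with h | h | h
  · rw [e₁]; exact key _ _ _ _ hb ha h
  · rw [e₂]; exact key _ _ _ _ ha hab h
  · rw [e₃]; exact key _ _ _ _ hb hab h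

lemma exists_planarCross_eq_of_mem_convexHull {w₁ w₂ w₃ x : EuclideanSpace ℝ (Fin 2)}
    (hx : x ∈ convexHull ℝ ({w₁, w₂, w₃} : Set (EuclideanSpace ℝ (Fin 2)))) :
    ∃ t ∈ Set.Icc (0 : ℝ) 1,
      planarCross (x - w₂) (w₃ - w₂) = t * planarCross (w₁ - w₂) (w₃ - w₂) := by
  refine convexHull_min (t := {x | ∃ t ∈ Set.Icc (0 : ℝ) 1,
      planarCross (x - w₂) (w₃ - w₂) = t * planarCross (w₁ - w₂) (w₃ - w₂)}) ?_ ?_ hx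
  · rintro y (rfl | rfl | rfl)
    · exact ⟨1, by simp, by simp⟩
    · exact ⟨0, by simp, by simp [planarCross]⟩
    · exact ⟨0, by simp, by simp only [planarCross]; ring⟩
  · rintro y ⟨s, hs, hy⟩ z ⟨t, ht, hz⟩ p q hp hq hpq
    refine ⟨p * s + q * t, convex_Icc (0 : ℝ) 1 hs ht hp hq hpq, ?_⟩
    rw [add_mul, mul_assoc, mul_assoc, ← hy, ← hz]
    obtain rfl : p = 1 - q := by linarith
    simp only [planarCross, PiLp.sub_apply, PiLp.add_apply, PiLp.smul_apply, smul_eq_mul]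
    ring

/-- The minimum altitude is at most the doubled area divided by the longest edge length. -/
lemma exists_edge_bound_minalt_le_div {u₁ u₂ u₃ : EuclideanSpace ℝ (Fin 2)}
    (h₁₂ : u₁ ≠ u₂) (h₁₃ : u₁ ≠ u₃) (h₂₃ : u₂ ≠ u₃) :
    ∃ L : ℝ, 0 < L ∧ ‖u₂ - u₁‖ ≤ L ∧ ‖u₃ - u₁‖ ≤ L ∧ ‖u₃ - u₂‖ ≤ L ∧
      minalt u₁ u₂ u₃ ≤ |planarCross (u₂ - u₁) (u₃ - u₁)| / L := by
  have p₁₂ : 0 < ‖u₂ - u₁‖ := norm_pos_iff.2 (sub_ne_zero.2 h₁₂.symm)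
  have p₁₃ : 0 < ‖u₃ - u₁‖ := norm_pos_iff.2 (sub_ne_zero.2 h₁₃.symm)
  have p₂₃ : 0 < ‖u₃ - u₂‖ := norm_pos_iff.2 (sub_ne_zero.2 h₂₃.symm)
  have c₁ : planarCross (u₁ - u₂) (u₃ - u₂) = -planarCross (u₂ - u₁) (u₃ - u₁) := by
    simp only [planarCross, PiLp.sub_apply]; ring
  have c₃ : planarCross (u₃ - u₁) (u₂ - u₁) = -planarCross (u₂ - u₁) (u₃ - u₁) := by
    simp only [planarCross, PiLp.sub_apply]; ring
  rw [minalt, infDist_line_eq _ _ _ h₂₃, infDist_line_eq _ _ _ h₁₃, infDist_line_eq _ _ _ h₁₂,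
    c₁, c₃, abs_neg]
  rcases le_total ‖u₂ - u₁‖ ‖u₃ - u₁‖ with h | h
  · rcases le_total ‖u₃ - u₁‖ ‖u₃ - u₂‖ with h' | h'
    · exact ⟨_, p₂₃, h.trans h', h', le_rfl, min_le_left _ _⟩
    · exact ⟨_, p₁₃, h, le_rfl, h', (min_le_right _ _).trans (min_le_left _ _)⟩
  · rcases le_total ‖u₂ - u₁‖ ‖u₃ - u₂‖ with h' | h'
    · exact ⟨_, p₂₃, h', h.trans h', le_rfl, min_le_left _ _⟩
    · exact ⟨_, p₁₂, le_rfl, h, h', (min_le_right _ _).trans (min_le_right _ _)⟩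

lemma minalt_le_infDist_of_subset {u₁ u₂ u₃ w₁ w₂ w₃ : EuclideanSpace ℝ (Fin 2)}
    (h₁₂ : u₁ ≠ u₂) (h₁₃ : u₁ ≠ u₃) (h₂₃ : u₂ ≠ u₃) (hw : w₂ ≠ w₃)
    (hsub : ({u₁, u₂, u₃} : Set (EuclideanSpace ℝ (Fin 2))) ⊆
      convexHull ℝ ({w₁, w₂, w₃} : Set (EuclideanSpace ℝ (Fin 2)))) :
    minalt u₁ u₂ u₃ ≤
      Metric.infDist w₁ (affineSpan ℝ {w₂, w₃} : Set (EuclideanSpace ℝ (Fin 2))) := by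
  obtain ⟨L, hL, l₁₂, l₁₃, l₂₃, hmin⟩ := exists_edge_bound_minalt_le_div h₁₂ h₁₃ h₂₃
  have hd : 0 < ‖w₃ - w₂‖ := norm_pos_iff.2 (sub_ne_zero.2 hw.symm)
  refine hmin.trans ?_
  rw [infDist_line_eq _ _ _ hw, div_le_div_iff₀ hL hd]
  have width : ∀ x ∈ ({u₁, u₂, u₃} : Set (EuclideanSpace ℝ (Fin 2))),
      ∀ y ∈ ({u₁, u₂, u₃} : Set (EuclideanSpace ℝ (Fin 2))),
      |planarCross (x - y) (w₃ - w₂)| ≤ |planarCross (w₁ - w₂) (w₃ - w₂)| := by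
    intro x hx y hy
    obtain ⟨s, ⟨hs₀, hs₁⟩, hs⟩ := exists_planarCross_eq_of_mem_convexHull (hsub hx)
    obtain ⟨t, ⟨ht₀, ht₁⟩, ht⟩ := exists_planarCross_eq_of_mem_convexHull (hsub hy)
    have e : planarCross (x - y) (w₃ - w₂) =
        (s - t) * planarCross (w₁ - w₂) (w₃ - w₂) := by
      rw [sub_mul, ← hs, ← ht]
      simp only [planarCross, PiLp.sub_apply]; ring
    rw [e, abs_mul]
    exact mul_le_of_le_one_left (abs_nonneg _) (abs_le.2 ⟨by linarith, by linarith⟩)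
  have hdiff : planarCross (u₂ - u₁) (w₃ - w₂) - planarCross (u₃ - u₁) (w₃ - w₂) =
      planarCross (u₂ - u₃) (w₃ - w₂) := by
    simp only [planarCross, PiLp.sub_apply]; ring
  rw [← Real.norm_eq_abs, ← norm_smul, planarCross_smul_eq, mul_comm _ L]
  refine norm_smul_sub_smul_le l₁₂ l₁₃ ?_ (width _ (by simp) _ (by simp))
    (width _ (by simp) _ (by simp)) (hdiff ▸ width _ (by simp) _ (by simp))
  rwa [sub_sub_sub_cancel_right, norm_sub_rev]

/-- If triangle `T₁` (with vertices `u₁ u₂ u₃`) is contained in triangle `T₂`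
(with vertices `w₁ w₂ w₃`), then `minalt T₁ ≤ minalt T₂`. -/
theorem minalt_mono_of_subset (u₁ u₂ u₃ w₁ w₂ w₃ : EuclideanSpace ℝ (Fin 2))
    (hu : AffineIndependent ℝ ![u₁, u₂, u₃])
    (hw : AffineIndependent ℝ ![w₁, w₂, w₃])
    (hsub : convexHull ℝ ({u₁, u₂, u₃} : Set (EuclideanSpace ℝ (Fin 2))) ⊆
      convexHull ℝ ({w₁, w₂, w₃} : Set (EuclideanSpace ℝ (Fin 2)))) :
    minalt u₁ u₂ u₃ ≤ minalt w₁ w₂ w₃ := by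
  have u₁₂ : u₁ ≠ u₂ := hu.injective.ne (show (0 : Fin 3) ≠ 1 by decide)
  have u₁₃ : u₁ ≠ u₃ := hu.injective.ne (show (0 : Fin 3) ≠ 2 by decide)
  have u₂₃ : u₂ ≠ u₃ := hu.injective.ne (show (1 : Fin 3) ≠ 2 by decide)
  have w₁₂ : w₁ ≠ w₂ := hw.injective.ne (show (0 : Fin 3) ≠ 1 by decide)
  have w₁₃ : w₁ ≠ w₃ := hw.injective.ne (show (0 : Fin 3) ≠ 2 by decide)
  have w₂₃ : w₂ ≠ w₃ := hw.injective.ne (show (1 : Fin 3) ≠ 2 by decide)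
  have hsub' := (subset_convexHull ℝ _).trans hsub
  refine le_min (minalt_le_infDist_of_subset u₁₂ u₁₃ u₂₃ w₂₃ hsub')
    (le_min (minalt_le_infDist_of_subset u₁₂ u₁₃ u₂₃ w₁₃ ?_)
      (minalt_le_infDist_of_subset u₁₂ u₁₃ u₂₃ w₁₂ ?_))
  · rwa [Set.insert_comm w₂]
  · rwa [Set.insert_comm w₃, Set.pair_comm w₃ w₂]
end

section
/- Let v₁, v₂, v₃ be affinely independent points in ℝ², let v₁' ∈ ℝ², and let A : ℝ² → ℝ² be the unique affine transformation satisfying A(v₂) = v₂, A(v₃) = v₃, and A(v₁) = v₁'. Set d = ‖v₁ − v₁'‖ and let α be the Euclidean distance from v₁ to the line through v₂ and v₃. Then for every pair of points x, y ∈ ℝ²: (1 − d/α)·‖x − y‖ ≤ ‖A(x) − A(y)‖ ≤ (1 + d/α)·‖x − y‖. -/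
open Real

/-- A vector with component `s` along `p - q` and `t` along `r - q` has norm at least `|s|` times
the distance from `p` to the line through `q` and `r`. -/
theorem abs_mul_infDist_affineSpan_pair_le_norm {E : Type*} [NormedAddCommGroup E]
    [NormedSpace ℝ E] (p q r : E) (s t : ℝ) :
    |s| * Metric.infDist p (affineSpan ℝ {q, r} : Set E) ≤ ‖s • (p - q) + t • (r - q)‖ := by
  rcases eq_or_ne s 0 with rfl | hs
  · simp
  have hle := Metric.infDist_le_dist_of_mem (x := p)
    (AffineMap.lineMap_mem_affineSpan_pair (-(t / s)) q r)
  have hz : s • (p - q) + t • (r - q) = s • (p - AffineMap.lineMap q r (-(t / s))) := by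
    rw [AffineMap.lineMap_apply_module']
    match_scalars <;> field_simp
    all_goals ring
  rw [hz, norm_smul, Real.norm_eq_abs, ← dist_eq_norm]
  exact mul_le_mul_of_nonneg_left hle (abs_nonneg s)

/-- The altitude of a nondegenerate triangle is positive. -/
theorem AffineIndependent.infDist_affineSpan_pair_pos {E : Type*} [NormedAddCommGroup E]
    [NormedSpace ℝ E] [FiniteDimensional ℝ E] {p q r : E}
    (h : AffineIndependent ℝ ![p, q, r]) :
    0 < Metric.infDist p (affineSpan ℝ {q, r} : Set E) := by
  refine ((AffineSubspace.closed_of_finiteDimensional _).notMem_iff_infDist_pos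
    ⟨q, left_mem_affineSpan_pair ℝ q r⟩).1 fun hp ↦ ?_
  exact affineIndependent_iff_not_collinear_set.1 h (collinear_insert_of_mem_affineSpan_pair hp)

/-- The edge vectors at a vertex of a nondegenerate triangle span the plane. -/
theorem AffineIndependent.exists_eq_smul_sub_add_smul_sub {E : Type*} [AddCommGroup E]
    [Module ℝ E] [FiniteDimensional ℝ E] (hE : Module.finrank ℝ E = 2) {p q r : E}
    (h : AffineIndependent ℝ ![p, q, r]) (z : E) :
    ∃ s t : ℝ, s • (p - q) + t • (r - q) = z := by
  have hz : z ∈ vectorSpan ℝ (Set.range ![p, q, r]) := by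
    rw [h.vectorSpan_eq_top_of_card_eq_finrank_add_one (by simp [hE])]
    exact Submodule.mem_top
  rw [vectorSpan_eq_span_vsub_set_right ℝ (show q ∈ Set.range ![p, q, r] from ⟨1, rfl⟩)] at hz
  have hedges : (· -ᵥ q) '' Set.range ![p, q, r] = insert 0 {p - q, r - q} := by
    simp only [Matrix.range_cons, Matrix.range_empty, Set.union_empty, Set.image_union,
      Set.image_singleton, vsub_eq_sub, sub_self]
    grind
  rwa [hedges, Submodule.span_insert_zero, Submodule.mem_span_pair] at hz

/-- Moving one vertex of a triangle by distance `d` while fixing the other two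
distorts every segment by a factor between `1 - d/α` and `1 + d/α`, where `α`
is the altitude of the moved vertex over the fixed edge. -/
theorem affine_vertex_move_distortion
    (v₁ v₂ v₃ v₁' : EuclideanSpace ℝ (Fin 2))
    (hind : AffineIndependent ℝ ![v₁, v₂, v₃])
    (A : EuclideanSpace ℝ (Fin 2) →ᵃ[ℝ] EuclideanSpace ℝ (Fin 2))
    (hA₂ : A v₂ = v₂) (hA₃ : A v₃ = v₃) (hA₁ : A v₁ = v₁')
    (d α : ℝ) (hd : d = ‖v₁ - v₁'‖)
    (hα : α = Metric.infDist v₁ (affineSpan ℝ {v₂, v₃} : Set (EuclideanSpace ℝ (Fin 2)))) :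
    ∀ x y : EuclideanSpace ℝ (Fin 2),
      (1 - d / α) * ‖x - y‖ ≤ ‖A x - A y‖ ∧ ‖A x - A y‖ ≤ (1 + d / α) * ‖x - y‖ := by
  intro x y
  have hα_pos : 0 < α := hα ▸ hind.infDist_affineSpan_pair_pos
  obtain ⟨s, t, hst⟩ := hind.exists_eq_smul_sub_add_smul_sub (by simp) (x - y)
  have hs : |s| * α ≤ ‖x - y‖ := by
    rw [hα, ← hst]
    exact abs_mul_infDist_affineSpan_pair_le_norm v₁ v₂ v₃ s t
  have hA : A x - A y = s • (v₁' - v₂) + t • (v₃ - v₂) := by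
    have hlin (a b : EuclideanSpace ℝ (Fin 2)) : A a - A b = A.linear (a - b) :=
      (A.linearMap_vsub a b).symm
    rw [hlin, ← hst, map_add, map_smul, map_smul, ← hlin, ← hlin, hA₁, hA₂, hA₃]
  have hdiff : ‖(A x - A y) - (x - y)‖ ≤ d / α * ‖x - y‖ := by
    have hmove : (A x - A y) - (x - y) = s • (v₁' - v₁) := by
      rw [hA, ← hst]
      module
    rw [hmove, norm_smul, Real.norm_eq_abs, norm_sub_rev, ← hd, div_mul_eq_mul_div,
      le_div_iff₀ hα_pos]
    nlinarith [mul_le_mul_of_nonneg_left hs (hd ▸ norm_nonneg (v₁ - v₁') : 0 ≤ d)]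
  have hupper := norm_sub_norm_le (A x - A y) (x - y)
  have hlower := norm_sub_norm_le (x - y) (A x - A y)
  rw [norm_sub_rev (x - y)] at hlower
  constructor <;> linarith
end

section
/- Let a, b, c be real numbers with a, b, c > 0 and a + b + c = π, and suppose b ≥ min(0.4, a) and c − a ≥ min(0.4, a). Then sin(a)/sin(c) ≤ 0.922. -/
open Real

/-- The sine on `[x, π - x]` is at least `sin x`. -/
lemma sin_le_sin_of_le_of_le_pi_sub {x y : ℝ} (hx : 0 ≤ x) (hxy : x ≤ y) (hy : y ≤ π - x) :
    sin x ≤ sin y := by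
  have hpi := pi_pos
  rcases le_total y (π / 2) with h | h
  · exact sin_le_sin_of_le_of_le_pi_div_two (by linarith) h hxy
  · rw [← sin_pi_sub y]
    exact sin_le_sin_of_le_of_le_pi_div_two (by linarith) (by linarith) (by linarith)

lemma cos_two_fifths_le : cos 0.4 ≤ 0.922 := by
  have h := (abs_le.mp (cos_bound (x := 0.4) (by norm_num [abs_of_pos]))).2
  rw [abs_of_pos (by norm_num)] at h
  norm_num at h ⊢
  linarith

/-- If `a, b, c` are the angles of a triangle (all positive, summing to `π`)
with `b ≥ min 0.4 a` and `c - a ≥ min 0.4 a`, then `sin a / sin c ≤ 0.922`. -/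
theorem sin_ratio_le (a b c : ℝ)
    (ha : 0 < a) (hb : 0 < b) (hc : 0 < c)
    (hsum : a + b + c = Real.pi)
    (hb' : b ≥ min 0.4 a) (hca : c - a ≥ min 0.4 a) :
    Real.sin a / Real.sin c ≤ 0.922 := by
  rw [div_le_iff₀ (sin_pos_of_pos_of_lt_pi hc (by linarith))]
  rcases le_total a 0.4 with h | h
  · rw [min_eq_right h] at hb' hca
    have hsin : sin (2 * a) ≤ sin c :=
      sin_le_sin_of_le_of_le_pi_sub (by linarith) (by linarith) (by linarith)
    rw [sin_two_mul] at hsin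
    have hcos : 0.92 ≤ cos a := by
      have := one_sub_sq_div_two_le_cos (x := a)
      norm_num at h ⊢
      nlinarith
    have hpos : 0 < sin a := sin_pos_of_pos_of_lt_pi ha (by linarith)
    norm_num at hcos ⊢
    nlinarith
  · rw [min_eq_left h] at hb' hca
    have hsin : sin (a + 0.4) ≤ sin c :=
      sin_le_sin_of_le_of_le_pi_sub (by positivity) (by linarith) (by linarith)
    have hpos : 0 ≤ sin (a + 0.4) :=
      sin_nonneg_of_nonneg_of_le_pi (by positivity) (by linarith)
    have hcos : 0 ≤ cos (a + 0.4) :=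
      cos_nonneg_of_neg_pi_div_two_le_of_le (by linarith) (by linarith)
    have hsin' : 0 ≤ sin 0.4 :=
      sin_nonneg_of_nonneg_of_le_pi (by norm_num) (by linarith)
    calc sin a = sin (a + 0.4) * cos 0.4 - cos (a + 0.4) * sin 0.4 := by
          rw [← sin_sub, add_sub_cancel_right]
      _ ≤ sin (a + 0.4) * cos 0.4 := sub_le_self _ (mul_nonneg hcos hsin')
      _ ≤ sin (a + 0.4) * 0.922 := mul_le_mul_of_nonneg_left cos_two_fifths_le hpos
      _ ≤ 0.922 * sin c := by rw [mul_comm]; gcongr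
end

section
/- Let a, b, c be real numbers with a, b, c > 0 and a + b + c = π, and suppose b ≥ min(0.4, a) and c − a ≥ min(0.4, a). Then sin(b)/sin(c − a) ≥ 1/3. -/
open Real

/-- The sine is at least `1 / 3` on `[0.4, π - 0.4]`. -/
lemma one_third_le_sin {x : ℝ} (h₁ : 0.4 ≤ x) (h₂ : x ≤ π - 0.4) : 1 / 3 ≤ sin x := by
  have h := sin_gt_sub_cube (x := 0.4) (by norm_num)
  have h₀ : (1 / 3 : ℝ) ≤ sin 0.4 := by norm_num at h ⊢; linarith
  have hpi := pi_gt_three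
  norm_num at h₀ h₁ h₂ ⊢
  rcases le_total x (π / 2) with hx | hx
  · exact h₀.trans (sin_le_sin_of_le_of_le_pi_div_two (by linarith) hx h₁)
  · rw [← sin_pi_sub x]
    exact h₀.trans (sin_le_sin_of_le_of_le_pi_div_two (by linarith) (by linarith) (by linarith))

lemma sin_add_two_mul_le {a b : ℝ} (ha : 0 ≤ a) (ha' : a ≤ π / 2) (hab : a ≤ b) (hb : b ≤ π) :
    sin (b + 2 * a) ≤ 3 * sin b := by
  have hsb : 0 ≤ sin b := sin_nonneg_of_nonneg_of_le_pi (ha.trans hab) hb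
  have hsa : 0 ≤ sin a := sin_nonneg_of_nonneg_of_le_pi ha (hab.trans hb)
  have hca : 0 ≤ cos a := cos_nonneg_of_neg_pi_div_two_le_of_le (by linarith) ha'
  have h₁ : sin b * cos (2 * a) ≤ sin b := mul_le_of_le_one_right hsb (cos_le_one _)
  have h₂ : sin a * cos a * cos b ≤ sin b := by
    rcases le_total b (π / 2) with hx | hx
    · have hs : sin a ≤ sin b := sin_le_sin_of_le_of_le_pi_div_two (by linarith) hx hab
      have hcb : 0 ≤ cos b := cos_nonneg_of_neg_pi_div_two_le_of_le (by linarith) hx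
      calc sin a * cos a * cos b = sin a * (cos a * cos b) := by ring
        _ ≤ sin a := mul_le_of_le_one_right hsa (mul_le_one₀ (cos_le_one a) hcb (cos_le_one b))
        _ ≤ sin b := hs
    · have hcb : cos b ≤ 0 := cos_nonpos_of_pi_div_two_le_of_le hx (by linarith)
      exact (mul_nonpos_of_nonneg_of_nonpos (mul_nonneg hsa hca) hcb).trans hsb
  rw [sin_add, sin_two_mul]
  linarith

/-- If `a, b, c` are the angles of a triangle (all positive, summing to `π`)
with `b ≥ min 0.4 a` and `c - a ≥ min 0.4 a`, then `sin b / sin (c - a) ≥ 1/3`. -/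
theorem sin_ratio_b_ca (a b c : ℝ)
    (ha : 0 < a) (hb : 0 < b) (hc : 0 < c)
    (hsum : a + b + c = Real.pi)
    (hb' : b ≥ min 0.4 a) (hca : c - a ≥ min 0.4 a) :
    Real.sin b / Real.sin (c - a) ≥ 1 / 3 := by
  have hmin : 0 < min 0.4 a := lt_min (by norm_num) ha
  have hpos : 0 < sin (c - a) := sin_pos_of_pos_of_lt_pi (by linarith) (by linarith)
  rw [ge_iff_le, le_div_iff₀ hpos]
  rcases le_total a 0.4 with h | h
  · rw [min_eq_right h] at hb' hca
    have hd : sin (c - a) = sin (b + 2 * a) := by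
      rw [← sin_pi_sub, ← hsum]
      ring_nf
    have hle := sin_add_two_mul_le ha.le (by linarith) hb' (by linarith)
    rw [hd]
    linarith
  · rw [min_eq_left h] at hb' hca
    have hle := one_third_le_sin hb' (by linarith)
    have hone := sin_le_one (c - a)
    linarith
end

section
/- Let a, b, c be real numbers with a, b, c > 0 and a + b + c = π, and suppose b ≥ min(0.4, a) and c − a ≥ min(0.4, a). Then sin(c − a)/sin(c) ≥ 0.389. -/
open Real

theorem sin_two_fifths_gt : 0.389 < Real.sin 0.4 := by
  have hs := (abs_le.1 (Real.sin_bound (x := 0.2) (by norm_num [abs_of_pos]))).1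
  have hc := Real.one_sub_sq_div_two_le_cos (x := 0.2)
  rw [abs_of_pos (by norm_num : (0 : ℝ) < 0.2)] at hs
  have hs' : (0.1985 : ℝ) ≤ Real.sin 0.2 := by norm_num at hs ⊢; linarith
  have hc' : (0.98 : ℝ) ≤ Real.cos 0.2 := by norm_num at hc ⊢; linarith
  rw [show (0.4 : ℝ) = 2 * 0.2 by norm_num, Real.sin_two_mul]
  nlinarith

/-- If `a, b, c` are the angles of a triangle (all positive, summing to `π`)
with `b ≥ min 0.4 a` and `c - a ≥ min 0.4 a`, then `sin (c - a) / sin c ≥ 0.389`. -/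
theorem sin_ratio_ca_c (a b c : ℝ)
    (ha : 0 < a) (hb : 0 < b) (hc : 0 < c)
    (hsum : a + b + c = Real.pi)
    (hb' : b ≥ min 0.4 a) (hca : c - a ≥ min 0.4 a) :
    Real.sin (c - a) / Real.sin c ≥ 0.389 := by
  have hsc : 0 < Real.sin c := Real.sin_pos_of_pos_of_lt_pi hc (by linarith)
  rw [ge_iff_le, le_div_iff₀ hsc]
  have hpi := Real.pi_gt_three
  rcases lt_or_ge (c - a) 0.4 with h | h
  · have had : a ≤ c - a := (min_le_iff.1 hca).resolve_left (not_le.2 h)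
    norm_num at h
    have hle : Real.sin c ≤ Real.sin (2 * (c - a)) :=
      Real.sin_le_sin_of_le_of_le_pi_div_two (by linarith) (by linarith) (by linarith)
    have hd : 0 < Real.sin (c - a) :=
      Real.sin_pos_of_pos_of_lt_pi (by linarith) (by linarith)
    rw [Real.sin_two_mul] at hle
    nlinarith [Real.cos_le_one (c - a)]
  · rcases le_or_gt (c - a) (Real.pi / 2) with h2 | h2
    · have hle : Real.sin 0.4 ≤ Real.sin (c - a) :=
        Real.sin_le_sin_of_le_of_le_pi_div_two (by norm_num; linarith) h2 h
      linarith [sin_two_fifths_gt, Real.sin_le_one c]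
    · have hle : Real.sin (Real.pi - c) ≤ Real.sin (Real.pi - (c - a)) :=
        Real.sin_le_sin_of_le_of_le_pi_div_two (by linarith) (by linarith) (by linarith)
      rw [Real.sin_pi_sub, Real.sin_pi_sub] at hle
      linarith
end

section
/- Let a, b, c be real numbers with a, b, c > 0 and a + b + c = π, and suppose b ≥ min(0.4, a) and c − a ≥ min(0.4, a). Then sin(b)/sin(c) ≥ 0.389. -/
open Real

/-- The numerical bound `0.389 ≤ sin 0.4`, obtained by the double-angle formula. -/
theorem le_sin_two_fifths : (0.389 : ℝ) ≤ Real.sin 0.4 := by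
  have hs := (abs_le.mp (Real.sin_bound (x := 0.2) (by norm_num [abs_of_pos]))).1
  rw [abs_of_pos (by norm_num : (0 : ℝ) < 0.2)] at hs
  have hs' : (0.1985 : ℝ) ≤ Real.sin 0.2 := by norm_num at hs ⊢; linarith
  have hc : (0.98 : ℝ) ≤ Real.cos 0.2 := by
    have h := Real.one_sub_sq_div_two_le_cos (x := 0.2)
    norm_num at h ⊢
    linarith
  have hd := Real.sin_two_mul 0.2
  rw [show (2 : ℝ) * 0.2 = 0.4 by norm_num] at hd
  rw [hd]
  nlinarith

/-- If `a, b, c` are the angles of a triangle (all positive, summing to `π`)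
with `b ≥ min 0.4 a` and `c - a ≥ min 0.4 a`, then `sin b / sin c ≥ 0.389`. -/
theorem sin_ratio_b_c (a b c : ℝ)
    (ha : 0 < a) (hb : 0 < b) (hc : 0 < c)
    (hsum : a + b + c = Real.pi)
    (hb' : b ≥ min 0.4 a) (hca : c - a ≥ min 0.4 a) :
    Real.sin b / Real.sin c ≥ 0.389 := by
  have hpi := Real.pi_gt_three
  have hsc : 0 < Real.sin c := Real.sin_pos_of_pos_of_lt_pi hc (by linarith)
  have hsb : 0 < Real.sin b := Real.sin_pos_of_pos_of_lt_pi hb (by linarith)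
  rw [ge_iff_le, le_div_iff₀ hsc]
  rcases lt_or_ge b 0.4 with h | h
  · have hab : a ≤ b := (min_le_iff.mp hb').resolve_left (not_le.mpr h)
    have hb2 : b < Real.pi / 2 := by norm_num at h; linarith
    have hsa : 0 < Real.sin a := Real.sin_pos_of_pos_of_lt_pi ha (by linarith)
    have hle : Real.sin a ≤ Real.sin b :=
      Real.sin_le_sin_of_le_of_le_pi_div_two (by linarith) hb2.le hab
    have hc' : Real.sin c = Real.sin a * Real.cos b + Real.cos a * Real.sin b := by
      rw [← Real.sin_add, ← Real.sin_pi_sub]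
      congr 1
      linarith
    have h1 := mul_le_of_le_one_right hsa.le (Real.cos_le_one b)
    have h2 := mul_le_of_le_one_left hsb.le (Real.cos_le_one a)
    norm_num
    linarith
  · rcases le_or_gt b (Real.pi / 2) with h2 | h2
    · have hle : Real.sin 0.4 ≤ Real.sin b :=
        Real.sin_le_sin_of_le_of_le_pi_div_two (by norm_num; linarith) h2 h
      linarith [le_sin_two_fifths, Real.sin_le_one c]
    · have hle : Real.sin c ≤ Real.sin (Real.pi - b) :=
        Real.sin_le_sin_of_le_of_le_pi_div_two (by linarith) (by linarith) (by linarith)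
      rw [Real.sin_pi_sub] at hle
      norm_num
      linarith
end
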